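/- arXiv:math/0604323 — 2 statements merged into one kernel-verified Lean document; each statement's English description precedes it below -/
import Mathlib

section
/- Fix 1 ≤ i ≤ n+1. The map sending a pair (W_•, ℓ), where W_• = (W_1 ⊂ … ⊂ W_n) is a complete flag of isotropic subspaces of F with dim W_j = j and ℓ ∈ W_{i−1}* (with the convention W_0 = 0), to the complete isotropic flag V_• of E defined by V_j = {w + ℓ(w)e_0 : w ∈ W_j} for 1 ≤ j ≤ i−1 and V_j = W_{j−1} ⊕ ℂe_0 for i ≤ j ≤ n+1, is a bijection from the set of such pairs onto the orbit O_i = {(V_1 ⊂ … ⊂ V_{n+1}) complete isotropic flag of E : e_0 ∈ V_i and e_0 ∉ V_{i−1}}. -/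
open Module Submodule

noncomputable section

variable {E : Type*} [AddCommGroup E] [Module ℂ E]

/-- A subspace is isotropic for a bilinear form. -/
def IsIsotropic (ω : LinearMap.BilinForm ℂ E) (V : Submodule ℂ E) : Prop :=
  ∀ x ∈ V, ∀ y ∈ V, ω x y = 0

/-- The complement `F = span(e₁, …, e_{2n})` of the kernel line `ℂe₀`. -/
def Fsub (n : ℕ) (e : Basis (Fin (2 * n + 1)) ℂ E) : Submodule ℂ E :=
  Submodule.span ℂ (Set.range fun i : Fin (2 * n) => e i.succ)

/-- A complete isotropic flag `0 = V₀ ⊂ V₁ ⊂ … ⊂ V_{n+1}` of `E`, `dim V_j = j`. -/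
def IsIsoFlagE (n : ℕ) (ω : LinearMap.BilinForm ℂ E)
    (V : Fin (n + 2) → Submodule ℂ E) : Prop :=
  V 0 = ⊥ ∧ (∀ i j : Fin (n + 2), i ≤ j → V i ≤ V j) ∧
    (∀ j : Fin (n + 2), finrank ℂ (V j) = (j : ℕ)) ∧
    (∀ j : Fin (n + 2), IsIsotropic ω (V j))

/-- A complete isotropic flag `0 = W₀ ⊂ W₁ ⊂ … ⊂ W_n` of the subspace `F`, `dim W_j = j`. -/
def IsIsoFlagF (n : ℕ) (ω : LinearMap.BilinForm ℂ E) (F : Submodule ℂ E)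
    (W : Fin (n + 1) → Submodule ℂ E) : Prop :=
  W 0 = ⊥ ∧ (∀ i j : Fin (n + 1), i ≤ j → W i ≤ W j) ∧
    (∀ j : Fin (n + 1), W j ≤ F) ∧
    (∀ j : Fin (n + 1), finrank ℂ (W j) = (j : ℕ)) ∧
    (∀ j : Fin (n + 1), IsIsotropic ω (W j))

/-- The flag `V_•` of `E` associated to the pair `(W_•, ℓ)`, where `ℓ ∈ (W_m)*`:
`V_j = Γ_{ℓ|_{W_j}}` (the graph `{w + ℓ(w)e₀ : w ∈ W_j}`) for `j ≤ m`, and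
`V_j = W_{j−1} ⊕ ℂe₀` for `m + 1 ≤ j ≤ n + 1`. -/
def flagGraphRel (n : ℕ) (e₀ : E) (m : Fin (n + 1)) (W : Fin (n + 1) → Submodule ℂ E)
    (hmono : ∀ i j : Fin (n + 1), i ≤ j → W i ≤ W j) (ℓ : ↥(W m) →ₗ[ℂ] ℂ)
    (V : Fin (n + 2) → Submodule ℂ E) : Prop :=
  (∀ (j : Fin (n + 1)) (hj : j ≤ m),
    V j.castSucc = LinearMap.range ((W j).subtype +
      (ℓ.comp (Submodule.inclusion (hmono j m hj))).smulRight e₀)) ∧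
  (∀ j : Fin (n + 1), m ≤ j → V j.succ = W j ⊔ Submodule.span ℂ {e₀})

/-- The projection `x ↦ x - c x • e₀` along `e₀` onto the kernel of `c`. -/
def projAlong (c : E →ₗ[ℂ] ℂ) (e₀ : E) : E →ₗ[ℂ] E :=
  LinearMap.id - c.smulRight e₀

/-- The shear `x ↦ x + L x • e₀`. -/
def shear (L : E →ₗ[ℂ] ℂ) (e₀ : E) : E →ₗ[ℂ] E :=
  LinearMap.id + L.smulRight e₀

@[simp] lemma projAlong_apply (c : E →ₗ[ℂ] ℂ) (e₀ x : E) :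
    projAlong c e₀ x = x - c x • e₀ := rfl

@[simp] lemma shear_apply (L : E →ₗ[ℂ] ℂ) (e₀ x : E) :
    shear L e₀ x = x + L x • e₀ := rfl

lemma range_graph_eq_map_shear (W : Submodule ℂ E) (l : W →ₗ[ℂ] ℂ) (L : E →ₗ[ℂ] ℂ) (e₀ : E)
    (h : ∀ x : W, L x = l x) :
    LinearMap.range (W.subtype + l.smulRight e₀) = W.map (shear L e₀) := by
  ext x
  simp only [LinearMap.mem_range, Submodule.mem_map]
  constructor
  · rintro ⟨w, rfl⟩
    exact ⟨w, w.2, by simp [h]⟩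
  · rintro ⟨w, hw, rfl⟩
    exact ⟨⟨w, hw⟩, by simp [← h]⟩

lemma exists_castSucc_or_succ {n : ℕ} (m : Fin (n + 1)) (k : Fin (n + 2)) :
    (∃ j : Fin (n + 1), j ≤ m ∧ k = j.castSucc) ∨ (∃ j : Fin (n + 1), m ≤ j ∧ k = j.succ) := by
  by_cases h : (k : ℕ) ≤ m
  · exact Or.inl ⟨⟨k, by omega⟩, h, rfl⟩
  · refine Or.inr ⟨⟨k - 1, by omega⟩, ?_, ?_⟩
    · simp only [Fin.le_def]; omega
    · ext; simp only [Fin.val_succ]; omega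

section Complement

variable {c : E →ₗ[ℂ] ℂ} {e₀ : E}

lemma coord_projAlong (hc : c e₀ = 1) (x : E) : c (projAlong c e₀ x) = 0 := by
  simp [hc]

lemma projAlong_add_smul (hc : c e₀ = 1) {w : E} (hw : c w = 0) (a : ℂ) :
    projAlong c e₀ (w + a • e₀) = w := by
  simp [hc, hw]

lemma notMem_of_le_ker (hc : c e₀ = 1) {W : Submodule ℂ E} (hW : W ≤ LinearMap.ker c) :
    e₀ ∉ W := fun h => by
  have h0 : c e₀ = 0 := hW h
  simp [hc] at h0

lemma notMem_map_shear (hc : c e₀ = 1) {W : Submodule ℂ E} (hW : W ≤ LinearMap.ker c)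
    (L : E →ₗ[ℂ] ℂ) : e₀ ∉ W.map (shear L e₀) := by
  rintro ⟨w, hw, h⟩
  have hp := projAlong_add_smul hc (hW hw) (L w)
  rw [← shear_apply, h] at hp
  have : w = 0 := by rw [← hp]; simp [hc]
  subst this
  simp only [map_zero] at h
  simp [← h] at hc

lemma finrank_map_shear (hc : c e₀ = 1) {W : Submodule ℂ E} (hW : W ≤ LinearMap.ker c)
    (L : E →ₗ[ℂ] ℂ) : finrank ℂ (W.map (shear L e₀)) = finrank ℂ W := by
  have hinj : Function.Injective ((shear L e₀).domRestrict W) := by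
    intro x y h
    have h' := congrArg (projAlong c e₀) h
    simp only [LinearMap.domRestrict_apply, shear_apply] at h'
    rw [projAlong_add_smul hc (hW x.2), projAlong_add_smul hc (hW y.2)] at h'
    exact Subtype.ext h'
  have := LinearMap.finrank_range_of_inj hinj
  rwa [LinearMap.range_domRestrict] at this

lemma finrank_sup_span [FiniteDimensional ℂ E] {W : Submodule ℂ E} (h : e₀ ∉ W) :
    finrank ℂ ↥(W ⊔ Submodule.span ℂ {e₀}) = finrank ℂ W + 1 := by
  have h0 : e₀ ≠ 0 := fun h' => h (h' ▸ W.zero_mem)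
  have hd : Disjoint W (Submodule.span ℂ {e₀}) := (Submodule.disjoint_span_singleton' h0).2 h
  have := Submodule.finrank_sup_add_finrank_inf_eq W (Submodule.span ℂ {e₀})
  rwa [hd.eq_bot, finrank_bot, add_zero, finrank_span_singleton h0] at this

lemma map_projAlong_map_shear (hc : c e₀ = 1) {W : Submodule ℂ E} (hW : W ≤ LinearMap.ker c)
    (L : E →ₗ[ℂ] ℂ) : (W.map (shear L e₀)).map (projAlong c e₀) = W := by
  ext x
  simp only [Submodule.mem_map, exists_exists_and_eq_and]
  constructor
  · rintro ⟨w, hw, rfl⟩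
    rwa [shear_apply, projAlong_add_smul hc (hW hw)]
  · exact fun hx => ⟨x, hx, projAlong_add_smul hc (hW hx) _⟩

lemma map_projAlong_sup_span (hc : c e₀ = 1) {W : Submodule ℂ E} (hW : W ≤ LinearMap.ker c) :
    (W ⊔ Submodule.span ℂ {e₀}).map (projAlong c e₀) = W := by
  ext x
  simp only [Submodule.mem_map, Submodule.mem_sup, Submodule.mem_span_singleton]
  constructor
  · rintro ⟨_, ⟨w, hw, _, ⟨a, rfl⟩, rfl⟩, rfl⟩
    rwa [projAlong_add_smul hc (hW hw)]
  · exact fun hx => ⟨x + (0 : ℂ) • e₀, ⟨x, hx, _, ⟨0, rfl⟩, rfl⟩, projAlong_add_smul hc (hW hx) _⟩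

lemma map_projAlong_sup_span_of_mem {V : Submodule ℂ E} (h : e₀ ∈ V) :
    V.map (projAlong c e₀) ⊔ Submodule.span ℂ {e₀} = V := by
  apply le_antisymm
  · refine sup_le ?_ ((Submodule.span_singleton_le_iff_mem _ _).2 h)
    rintro _ ⟨v, hv, rfl⟩
    exact V.sub_mem hv (V.smul_mem _ h)
  · intro v hv
    refine Submodule.mem_sup.2 ⟨_, ⟨v, hv, rfl⟩, c v • e₀,
      Submodule.mem_span_singleton.2 ⟨_, rfl⟩, by simp⟩

lemma map_projAlong_le_ker (hc : c e₀ = 1) (V : Submodule ℂ E) :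
    V.map (projAlong c e₀) ≤ LinearMap.ker c := by
  rintro _ ⟨v, -, rfl⟩
  exact coord_projAlong hc v

/-- A subspace missing `e₀` is the graph of a linear form over its projection. -/
lemma exists_coord_eq_comp_projAlong {V : Submodule ℂ E} (h : e₀ ∉ V) :
    ∃ L : E →ₗ[ℂ] ℂ, ∀ v ∈ V, L (projAlong c e₀ v) = c v := by
  obtain ⟨g, hg⟩ := LinearMap.exists_leftInverse_of_injective ((projAlong c e₀).domRestrict V) (by
    rw [LinearMap.ker_eq_bot']
    rintro ⟨v, hv⟩ hv0
    have hve : v = c v • e₀ := sub_eq_zero.1 hv0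
    by_cases hcv : c v = 0
    · rw [hcv, zero_smul] at hve
      exact Subtype.ext hve
    · rw [hve] at hv
      exact absurd ((V.smul_mem_iff hcv).1 hv) h)
  refine ⟨c ∘ₗ V.subtype ∘ₗ g, fun v hv => ?_⟩
  have := LinearMap.congr_fun hg ⟨v, hv⟩
  simp only [LinearMap.comp_apply, LinearMap.domRestrict_apply, LinearMap.id_apply] at this
  simp only [LinearMap.comp_apply, this, Submodule.subtype_apply]

lemma map_shear_map_projAlong {L : E →ₗ[ℂ] ℂ} {V : Submodule ℂ E}
    (h : ∀ v ∈ V, L (projAlong c e₀ v) = c v) :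
    (V.map (projAlong c e₀)).map (shear L e₀) = V := by
  have key : ∀ v ∈ V, shear L e₀ (projAlong c e₀ v) = v := fun v hv => by
    rw [shear_apply, h v hv, projAlong_apply, sub_add_cancel]
  ext x
  simp only [Submodule.mem_map, exists_exists_and_eq_and]
  constructor
  · rintro ⟨v, hv, rfl⟩
    rwa [key v hv]
  · exact fun hx => ⟨x, hx, key x hx⟩

lemma finrank_map_projAlong (hc : c e₀ = 1) {V : Submodule ℂ E} (h : e₀ ∉ V) :
    finrank ℂ (V.map (projAlong c e₀)) = finrank ℂ V := by
  obtain ⟨L, hL⟩ := exists_coord_eq_comp_projAlong (c := c) h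
  rw [← finrank_map_shear hc (map_projAlong_le_ker hc V) L, map_shear_map_projAlong hL]

lemma finrank_map_projAlong_of_mem [FiniteDimensional ℂ E] (hc : c e₀ = 1) {V : Submodule ℂ E}
    (h : e₀ ∈ V) : finrank ℂ (V.map (projAlong c e₀)) + 1 = finrank ℂ V := by
  rw [← finrank_sup_span (notMem_of_le_ker hc (map_projAlong_le_ker hc V)),
    map_projAlong_sup_span_of_mem h]

end Complement

section Isotropic

variable {ω : LinearMap.BilinForm ℂ E} {e₀ : E}

lemma IsIsotropic.map_shear (h₁ : ∀ x, ω e₀ x = 0) (h₂ : ∀ x, ω x e₀ = 0) {V : Submodule ℂ E}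
    (hV : IsIsotropic ω V) (L : E →ₗ[ℂ] ℂ) : IsIsotropic ω (V.map (shear L e₀)) := by
  rintro _ ⟨x, hx, rfl⟩ _ ⟨y, hy, rfl⟩
  simp [h₁, h₂, hV x hx y hy]

lemma IsIsotropic.map_projAlong (h₁ : ∀ x, ω e₀ x = 0) (h₂ : ∀ x, ω x e₀ = 0)
    {V : Submodule ℂ E} (hV : IsIsotropic ω V) (c : E →ₗ[ℂ] ℂ) :
    IsIsotropic ω (V.map (projAlong c e₀)) := by
  rintro _ ⟨x, hx, rfl⟩ _ ⟨y, hy, rfl⟩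
  simp [h₁, h₂, hV x hx y hy]

lemma IsIsotropic.sup_span (h₁ : ∀ x, ω e₀ x = 0) (h₂ : ∀ x, ω x e₀ = 0) {V : Submodule ℂ E}
    (hV : IsIsotropic ω V) : IsIsotropic ω (V ⊔ Submodule.span ℂ {e₀}) := by
  intro x hx y hy
  simp only [Submodule.mem_sup, Submodule.mem_span_singleton] at hx hy
  obtain ⟨x, hx, _, ⟨a, rfl⟩, rfl⟩ := hx
  obtain ⟨y, hy, _, ⟨b, rfl⟩, rfl⟩ := hy
  simp [h₁, h₂, hV x hx y hy]

end Isotropic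

lemma Fsub_eq_ker_coord (n : ℕ) (e : Basis (Fin (2 * n + 1)) ℂ E) :
    Fsub n e = LinearMap.ker (e.coord 0) := by
  apply le_antisymm
  · refine Submodule.span_le.2 ?_
    rintro _ ⟨i, rfl⟩
    simp
  · intro x hx
    have hx0 : e.repr x 0 = 0 := hx
    rw [← e.sum_repr x, Fin.sum_univ_succ, hx0, zero_smul, zero_add]
    exact Submodule.sum_mem _ fun i _ =>
      Submodule.smul_mem _ _ (Submodule.subset_span ⟨i, rfl⟩)

lemma form_basis_zero_eq_zero (n : ℕ) (ω : LinearMap.BilinForm ℂ E) (halt : ω.IsAlt)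
    (e : Basis (Fin (2 * n + 1)) ℂ E)
    (he : ∀ i j : Fin (2 * n + 1), (i : ℕ) < (j : ℕ) →
      ω (e i) (e j) = if (i : ℕ) + (j : ℕ) = 2 * n + 1 then 1 else 0) :
    ω (e 0) = 0 := by
  refine e.ext fun j => ?_
  rcases Nat.eq_zero_or_pos (j : ℕ) with h | h
  · rw [show j = 0 from Fin.ext h]
    exact halt _
  · rw [he 0 j h, if_neg (by have := j.2; simp only [Fin.val_zero]; omega)]
    rfl

lemma flagGraphRel_iff {n : ℕ} {e₀ : E} {m : Fin (n + 1)} {W : Fin (n + 1) → Submodule ℂ E}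
    {hmono : ∀ i j : Fin (n + 1), i ≤ j → W i ≤ W j} {l : ↥(W m) →ₗ[ℂ] ℂ}
    {V : Fin (n + 2) → Submodule ℂ E} {L : E →ₗ[ℂ] ℂ} (hL : ∀ x : W m, L x = l x) :
    flagGraphRel n e₀ m W hmono l V ↔
      (∀ j ≤ m, V j.castSucc = (W j).map (shear L e₀)) ∧
      (∀ j, m ≤ j → V j.succ = W j ⊔ Submodule.span ℂ {e₀}) := by
  have key : ∀ (j : Fin (n + 1)) (hj : j ≤ m), LinearMap.range ((W j).subtype +
      (l.comp (Submodule.inclusion (hmono j m hj))).smulRight e₀) = (W j).map (shear L e₀) :=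
    fun j hj => range_graph_eq_map_shear _ _ _ _ fun x => hL (Submodule.inclusion (hmono j m hj) x)
  refine and_congr (forall₂_congr fun j hj => ?_) Iff.rfl
  rw [key j hj]

lemma exists_extend_apply {W : Submodule ℂ E} (l : W →ₗ[ℂ] ℂ) :
    ∃ L : E →ₗ[ℂ] ℂ, ∀ x : W, L x = l x := by
  obtain ⟨L, hL⟩ := l.exists_extend
  exact ⟨L, fun x => LinearMap.congr_fun hL x⟩

lemma exists_flagGraphRel {n : ℕ} (e₀ : E) (m : Fin (n + 1)) (W : Fin (n + 1) → Submodule ℂ E)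
    (hmono : ∀ i j : Fin (n + 1), i ≤ j → W i ≤ W j) (l : ↥(W m) →ₗ[ℂ] ℂ) :
    ∃ V, flagGraphRel n e₀ m W hmono l V := by
  obtain ⟨L, hL⟩ := exists_extend_apply l
  refine ⟨fun k => if h : (k : ℕ) ≤ m then (W ⟨k, by omega⟩).map (shear L e₀)
    else W ⟨k - 1, by omega⟩ ⊔ Submodule.span ℂ {e₀}, (flagGraphRel_iff hL).2 ⟨?_, ?_⟩⟩
  · intro j hj
    have hj' : (j.castSucc : ℕ) ≤ m := hj
    exact dif_pos hj'
  · intro j hj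
    have hj' : ¬ (j.succ : ℕ) ≤ m := by
      have := Fin.le_def.1 hj
      simp only [Fin.val_succ]; omega
    exact dif_neg hj'

lemma flagGraphRel.unique {n : ℕ} {e₀ : E} {m : Fin (n + 1)} {W : Fin (n + 1) → Submodule ℂ E}
    {hmono : ∀ i j : Fin (n + 1), i ≤ j → W i ≤ W j} {l : ↥(W m) →ₗ[ℂ] ℂ}
    {V V' : Fin (n + 2) → Submodule ℂ E} (h : flagGraphRel n e₀ m W hmono l V)
    (h' : flagGraphRel n e₀ m W hmono l V') : V = V' := by
  funext k
  rcases exists_castSucc_or_succ m k with ⟨j, hj, rfl⟩ | ⟨j, hj, rfl⟩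
  · rw [h.1 j hj, h'.1 j hj]
  · rw [h.2 j hj, h'.2 j hj]

section Flags

variable {n : ℕ} {ω : LinearMap.BilinForm ℂ E} {c : E →ₗ[ℂ] ℂ} {e₀ : E} {m : Fin (n + 1)}

lemma flagGraphRel.isIsoFlagE [FiniteDimensional ℂ E] (hc : c e₀ = 1) (h₁ : ∀ x, ω e₀ x = 0)
    (h₂ : ∀ x, ω x e₀ = 0) {W : Fin (n + 1) → Submodule ℂ E}
    (hW : IsIsoFlagF n ω (LinearMap.ker c) W) {l : ↥(W m) →ₗ[ℂ] ℂ}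
    {V : Fin (n + 2) → Submodule ℂ E} (h : flagGraphRel n e₀ m W hW.2.1 l V) :
    IsIsoFlagE n ω V ∧ e₀ ∈ V m.succ ∧ e₀ ∉ V m.castSucc := by
  obtain ⟨L, hL⟩ := exists_extend_apply l
  obtain ⟨hlow, hup⟩ := (flagGraphRel_iff hL).1 h
  obtain ⟨hW0, hmono, hF, hdim, hiso⟩ := hW
  refine ⟨⟨?_, ?_, ?_, ?_⟩, ?_, ?_⟩
  · rw [← Fin.castSucc_zero, hlow 0 (Fin.zero_le _), hW0, Submodule.map_bot]
  · intro i j hij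
    rcases exists_castSucc_or_succ m i with ⟨i, hi, rfl⟩ | ⟨i, hi, rfl⟩ <;>
      rcases exists_castSucc_or_succ m j with ⟨j, hj, rfl⟩ | ⟨j, hj, rfl⟩
    · rw [hlow i hi, hlow j hj]
      exact Submodule.map_mono (hmono i j hij)
    · rw [hlow i hi, hup j hj]
      rintro _ ⟨w, hw, rfl⟩
      exact Submodule.add_mem_sup (hmono i j (hi.trans hj) hw)
        (Submodule.mem_span_singleton.2 ⟨_, rfl⟩)
    · simp only [Fin.le_def, Fin.val_succ, Fin.val_castSucc] at hij hi hj
      omega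
    · rw [hup i hi, hup j hj]
      exact sup_le_sup_right (hmono i j (Fin.succ_le_succ_iff.1 hij)) _
  · intro k
    rcases exists_castSucc_or_succ m k with ⟨j, hj, rfl⟩ | ⟨j, hj, rfl⟩
    · rw [hlow j hj, finrank_map_shear hc (hF j), hdim j, Fin.val_castSucc]
    · rw [hup j hj, finrank_sup_span (notMem_of_le_ker hc (hF j)), hdim j, Fin.val_succ]
  · intro k
    rcases exists_castSucc_or_succ m k with ⟨j, hj, rfl⟩ | ⟨j, hj, rfl⟩
    · rw [hlow j hj]
      exact (hiso j).map_shear h₁ h₂ L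
    · rw [hup j hj]
      exact (hiso j).sup_span h₁ h₂
  · rw [hup m le_rfl]
    exact Submodule.mem_sup_right (Submodule.mem_span_singleton_self _)
  · rw [hlow m le_rfl]
    exact notMem_map_shear hc (hF m) L

lemma IsIsoFlagE.exists_flagGraphRel [FiniteDimensional ℂ E] (hc : c e₀ = 1)
    (h₁ : ∀ x, ω e₀ x = 0) (h₂ : ∀ x, ω x e₀ = 0) {V : Fin (n + 2) → Submodule ℂ E}
    (hV : IsIsoFlagE n ω V) (hmem : e₀ ∈ V m.succ) (hnot : e₀ ∉ V m.castSucc) :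
    ∃ (W : Fin (n + 1) → Submodule ℂ E) (hW : IsIsoFlagF n ω (LinearMap.ker c) W)
      (l : ↥(W m) →ₗ[ℂ] ℂ), flagGraphRel n e₀ m W hW.2.1 l V := by
  obtain ⟨hV0, hmono, hdim, hiso⟩ := hV
  have hmem' : ∀ j, m ≤ j → e₀ ∈ V j.succ := fun j hj =>
    hmono _ _ (Fin.succ_le_succ_iff.2 hj) hmem
  have hnot' : ∀ j ≤ m, e₀ ∉ V j.castSucc := fun j hj h =>
    hnot (hmono _ _ (Fin.castSucc_le_castSucc_iff.2 hj) h)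
  obtain ⟨L, hL⟩ := exists_coord_eq_comp_projAlong (c := c) hnot
  let W : Fin (n + 1) → Submodule ℂ E := fun j =>
    (V (if j ≤ m then j.castSucc else j.succ)).map (projAlong c e₀)
  have hlow : ∀ j ≤ m, W j = (V j.castSucc).map (projAlong c e₀) := fun j hj => by
    simp only [W, if_pos hj]
  have hup : ∀ j, m < j → W j = (V j.succ).map (projAlong c e₀) := fun j hj => by
    simp only [W, if_neg (not_le.2 hj)]
  have hW : IsIsoFlagF n ω (LinearMap.ker c) W := by
    refine ⟨?_, ?_, fun j => map_projAlong_le_ker hc _, ?_,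
      fun j => (hiso _).map_projAlong h₁ h₂ c⟩
    · rw [hlow 0 (Fin.zero_le _), Fin.castSucc_zero, hV0, Submodule.map_bot]
    · intro i j hij
      refine Submodule.map_mono (hmono _ _ ?_)
      simp only [Fin.le_def] at *
      split_ifs <;> simp only [Fin.val_succ, Fin.val_castSucc] <;> omega
    · intro j
      rcases le_or_gt j m with hj | hj
      · rw [hlow j hj, finrank_map_projAlong hc (hnot' j hj), hdim, Fin.val_castSucc]
      · have := finrank_map_projAlong_of_mem hc (hmem' j hj.le)
        rw [hdim, Fin.val_succ, ← hup j hj] at this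
        omega
  have hWm : W m = (V m.succ).map (projAlong c e₀) := by
    apply Submodule.eq_of_le_of_finrank_eq
    · rw [hlow m le_rfl]
      exact Submodule.map_mono (hmono _ _ (Fin.castSucc_lt_succ).le)
    · have := finrank_map_projAlong_of_mem hc hmem
      rw [hdim, Fin.val_succ] at this
      rw [hW.2.2.2.1 m]
      omega
  refine ⟨W, hW, L.domRestrict (W m), (flagGraphRel_iff (L := L) fun _ => rfl).2 ⟨?_, ?_⟩⟩
  · intro j hj
    rw [hlow j hj, map_shear_map_projAlong]
    exact fun v hv => hL v (hmono _ _ (Fin.castSucc_le_castSucc_iff.2 hj) hv)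
  · intro j hj
    have hWj : W j = (V j.succ).map (projAlong c e₀) := by
      rcases hj.eq_or_lt with rfl | hj
      · exact hWm
      · exact hup j hj
    rw [hWj, map_projAlong_sup_span_of_mem (hmem' j hj)]

lemma flagGraphRel.eq_map_projAlong (hc : c e₀ = 1) {W : Fin (n + 1) → Submodule ℂ E}
    (hW : IsIsoFlagF n ω (LinearMap.ker c) W) {l : ↥(W m) →ₗ[ℂ] ℂ}
    {V : Fin (n + 2) → Submodule ℂ E} (h : flagGraphRel n e₀ m W hW.2.1 l V) (j : Fin (n + 1)) :
    W j = (V (if j ≤ m then j.castSucc else j.succ)).map (projAlong c e₀) := by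
  obtain ⟨L, hL⟩ := exists_extend_apply l
  obtain ⟨hlow, hup⟩ := (flagGraphRel_iff hL).1 h
  have hF := hW.2.2.1 j
  split_ifs with hj
  · rw [hlow j hj, map_projAlong_map_shear hc hF]
  · rw [hup j (not_le.1 hj).le, map_projAlong_sup_span hc hF]

lemma flagGraphRel.mem_castSucc_iff (hc : c e₀ = 1) {W : Fin (n + 1) → Submodule ℂ E}
    (hW : IsIsoFlagF n ω (LinearMap.ker c) W) {l : ↥(W m) →ₗ[ℂ] ℂ}
    {V : Fin (n + 2) → Submodule ℂ E} (h : flagGraphRel n e₀ m W hW.2.1 l V)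
    {x : E} (hx : x ∈ W m) (a : ℂ) : x + a • e₀ ∈ V m.castSucc ↔ a = l ⟨x, hx⟩ := by
  obtain ⟨L, hL⟩ := exists_extend_apply l
  rw [((flagGraphRel_iff hL).1 h).1 m le_rfl, ← hL ⟨x, hx⟩]
  have hF := hW.2.2.1 m
  constructor
  · rintro ⟨w, hw, hwx⟩
    have hcw : c w = 0 := hF hw
    have hcx : c x = 0 := hF hx
    have hp := congrArg (projAlong c e₀) hwx
    rw [shear_apply, projAlong_add_smul hc hcw, projAlong_add_smul hc hcx] at hp
    subst hp
    have := congrArg c hwx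
    simpa [hc, hcw] using this.symm
  · rintro rfl
    exact ⟨x, hx, rfl⟩

end Flags

/-- Fix `1 ≤ i ≤ n+1`, written here as `i = m+1` with `m : Fin (n+1)`.
The map sending a pair `(W_•, ℓ)`, with `W_•` a complete isotropic flag of `F` and
`ℓ ∈ (W_{i−1})*`, to the complete isotropic flag `V_•` of `E` given by
`V_j = Γ_{ℓ|_{W_j}}` for `j ≤ i−1` and `V_j = W_{j−1} ⊕ ℂe₀` for `i ≤ j ≤ n+1`, is a
bijection onto the orbit `O_i = {V_• : e₀ ∈ V_i, e₀ ∉ V_{i−1}}`. -/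
theorem flag_orbit_parametrization
    (n : ℕ) (hn : 1 ≤ n) [FiniteDimensional ℂ E] (hdim : finrank ℂ E = 2 * n + 1)
    (ω : LinearMap.BilinForm ℂ E) (halt : ω.IsAlt)
    (e : Basis (Fin (2 * n + 1)) ℂ E)
    (he : ∀ i j : Fin (2 * n + 1), (i : ℕ) < (j : ℕ) →
      ω (e i) (e j) = if (i : ℕ) + (j : ℕ) = 2 * n + 1 then 1 else 0)
    (m : Fin (n + 1)) :
    -- the map is well defined, with image inside the orbit O_{m+1} …
    (∀ (W : Fin (n + 1) → Submodule ℂ E) (hW : IsIsoFlagF n ω (Fsub n e) W)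
        (ℓ : ↥(W m) →ₗ[ℂ] ℂ),
      ∃ V : Fin (n + 2) → Submodule ℂ E,
        flagGraphRel n (e 0) m W hW.2.1 ℓ V ∧ IsIsoFlagE n ω V ∧
          e 0 ∈ V m.succ ∧ e 0 ∉ V m.castSucc) ∧
    -- … the image flag is uniquely determined …
    (∀ (W : Fin (n + 1) → Submodule ℂ E) (hW : IsIsoFlagF n ω (Fsub n e) W)
        (ℓ : ↥(W m) →ₗ[ℂ] ℂ) (V V' : Fin (n + 2) → Submodule ℂ E),
      flagGraphRel n (e 0) m W hW.2.1 ℓ V → flagGraphRel n (e 0) m W hW.2.1 ℓ V' →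
        V = V') ∧
    -- … the map is surjective onto the orbit O_{m+1} …
    (∀ V : Fin (n + 2) → Submodule ℂ E, IsIsoFlagE n ω V →
      e 0 ∈ V m.succ → e 0 ∉ V m.castSucc →
      ∃ (W : Fin (n + 1) → Submodule ℂ E) (hW : IsIsoFlagF n ω (Fsub n e) W)
        (ℓ : ↥(W m) →ₗ[ℂ] ℂ), flagGraphRel n (e 0) m W hW.2.1 ℓ V) ∧
    -- … and it is injective
    (∀ (W₁ : Fin (n + 1) → Submodule ℂ E) (hW₁ : IsIsoFlagF n ω (Fsub n e) W₁)
        (ℓ₁ : ↥(W₁ m) →ₗ[ℂ] ℂ)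
        (W₂ : Fin (n + 1) → Submodule ℂ E) (hW₂ : IsIsoFlagF n ω (Fsub n e) W₂)
        (ℓ₂ : ↥(W₂ m) →ₗ[ℂ] ℂ)
        (V : Fin (n + 2) → Submodule ℂ E),
      flagGraphRel n (e 0) m W₁ hW₁.2.1 ℓ₁ V → flagGraphRel n (e 0) m W₂ hW₂.2.1 ℓ₂ V →
        (W₁ = W₂ ∧ ∀ (x : E) (hx₁ : x ∈ W₁ m) (hx₂ : x ∈ W₂ m),
          ℓ₁ ⟨x, hx₁⟩ = ℓ₂ ⟨x, hx₂⟩)) := by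
  have hc : e.coord 0 (e 0) = 1 := by simp
  have hω := form_basis_zero_eq_zero n ω halt e he
  have h₁ : ∀ x, ω (e 0) x = 0 := fun x => by rw [hω]; rfl
  have h₂ : ∀ x, ω x (e 0) = 0 := fun x => by rw [← halt.neg_eq, h₁, neg_zero]
  rw [Fsub_eq_ker_coord]
  refine ⟨?_, fun W hW ℓ V V' h h' => h.unique h', ?_, ?_⟩
  · intro W hW ℓ
    obtain ⟨V, hV⟩ := exists_flagGraphRel (e 0) m W hW.2.1 ℓ
    exact ⟨V, hV, hV.isIsoFlagE hc h₁ h₂ hW⟩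
  · exact fun V hV hmem hnot => hV.exists_flagGraphRel hc h₁ h₂ hmem hnot
  · intro W₁ hW₁ ℓ₁ W₂ hW₂ ℓ₂ V hV₁ hV₂
    refine ⟨?_, fun x hx₁ hx₂ => ?_⟩
    · funext j
      rw [hV₁.eq_map_projAlong hc hW₁ j, hV₂.eq_map_projAlong hc hW₂ j]
    · rw [← hV₂.mem_castSucc_iff hc hW₂ hx₂, hV₁.mem_castSucc_iff hc hW₁ hx₁]

end
end

section
/- Fix 1 ≤ k ≤ n+1. Two k-dimensional isotropic subspaces V and V′ of E lie in the same orbit of B if and only if they have the same incidence with the flag E_•, i.e. dim(V ∩ E_j) = dim(V′ ∩ E_j) for all 1 ≤ j ≤ 2n+1. (Hence the Schubert cells of the odd symplectic grassmannian, defined by incidence conditions, are exactly the B-orbits.) -/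
open Module Submodule

noncomputable section

variable {E : Type*} [AddCommGroup E] [Module ℂ E]

/-- The group of linear automorphisms preserving a bilinear form
(the odd symplectic group of the form). -/
def sympGroup (ω : LinearMap.BilinForm ℂ E) : Subgroup (E ≃ₗ[ℂ] E) where
  carrier := {g | ∀ x y : E, ω (g x) (g y) = ω x y}
  one_mem' := fun _ _ => rfl
  mul_mem' := by
    intro a b ha hb x y
    simp only [Set.mem_setOf_eq] at ha hb ⊢
    rw [show (a * b) x = a (b x) from rfl, show (a * b) y = a (b y) from rfl, ha, hb]
  inv_mem' := by
    intro a ha x y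
    simp only [Set.mem_setOf_eq] at ha ⊢
    have h1 : a ((a⁻¹ : E ≃ₗ[ℂ] E) x) = x := a.apply_symm_apply x
    have h2 : a ((a⁻¹ : E ≃ₗ[ℂ] E) y) = y := a.apply_symm_apply y
    calc ω ((a⁻¹ : E ≃ₗ[ℂ] E) x) ((a⁻¹ : E ≃ₗ[ℂ] E) y)
        = ω (a ((a⁻¹ : E ≃ₗ[ℂ] E) x)) (a ((a⁻¹ : E ≃ₗ[ℂ] E) y)) := (ha _ _).symm
      _ = ω x y := by rw [h1, h2]

/-- The reference flag: `Efl j = span(e₀, …, e_{j−1})` (so `Efl 0 = 0`). -/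
def Efl (n : ℕ) (e : Basis (Fin (2 * n + 1)) ℂ E) (j : ℕ) : Submodule ℂ E :=
  Submodule.span ℂ (e '' {i : Fin (2 * n + 1) | (i : ℕ) < j})

section Flag

variable {n : ℕ} {e : Basis (Fin (2 * n + 1)) ℂ E}

lemma mem_Efl_iff {j : ℕ} {x : E} :
    x ∈ Efl n e j ↔ ∀ i : Fin (2 * n + 1), j ≤ (i : ℕ) → e.repr x i = 0 := by
  rw [Efl, Basis.mem_span_image]
  constructor
  · intro h i hi
    by_contra hne
    have : (i : ℕ) < j := h (Finsupp.mem_support_iff.mpr hne)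
    omega
  · intro h i hi
    by_contra hlt
    exact Finsupp.mem_support_iff.mp hi (h i (not_lt.mp hlt))

lemma basis_mem_Efl {i : Fin (2 * n + 1)} {j : ℕ} (h : (i : ℕ) < j) : e i ∈ Efl n e j :=
  subset_span ⟨i, h, rfl⟩

lemma Efl_mono {a b : ℕ} (h : a ≤ b) : Efl n e a ≤ Efl n e b :=
  span_mono (Set.image_mono fun _ hi => lt_of_lt_of_le hi h)

lemma Efl_zero : Efl n e 0 = ⊥ := by
  simp [Efl]

lemma Efl_eq_top {j : ℕ} (h : 2 * n + 1 ≤ j) : Efl n e j = ⊤ := by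
  rw [eq_top_iff]
  intro x _
  rw [mem_Efl_iff]
  intro i hi
  omega

lemma sub_smul_mem_Efl {j : Fin (2 * n + 1)} {x : E} (hx : x ∈ Efl n e (j + 1)) :
    x - e.repr x j • e j ∈ Efl n e j := by
  rw [mem_Efl_iff] at hx ⊢
  intro i hi
  rcases eq_or_ne i j with rfl | hij
  · simp
  · have : (i : ℕ) ≠ j := fun h => hij (Fin.ext h)
    simp [hx i (by omega), Finsupp.single_eq_of_ne hij]

/-- A family whose `i`-th member is `e i` up to lower terms of the flag. -/
def IsUnitriangular (n : ℕ) (e : Basis (Fin (2 * n + 1)) ℂ E) (f : Fin (2 * n + 1) → E) : Prop :=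
  ∀ i : Fin (2 * n + 1), f i - e i ∈ Efl n e i

/-- The indices at which the incidence of `V` with the flag jumps. -/
def jumpSet (n : ℕ) (e : Basis (Fin (2 * n + 1)) ℂ E) (V : Submodule ℂ E) :
    Set (Fin (2 * n + 1)) :=
  {i | ∃ v ∈ V, v - e i ∈ Efl n e i}

lemma IsUnitriangular.mem_Efl {f : Fin (2 * n + 1) → E} (hf : IsUnitriangular n e f)
    {i : Fin (2 * n + 1)} {j : ℕ} (h : (i : ℕ) < j) : f i ∈ Efl n e j := by
  have := add_mem (Efl_mono h.le (hf i)) (basis_mem_Efl (e := e) h)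
  simpa using this

lemma IsUnitriangular.map_constr_Efl {f : Fin (2 * n + 1) → E} (hf : IsUnitriangular n e f)
    {j : ℕ} (hj : j ≤ 2 * n + 1) : (Efl n e j).map (e.constr ℂ f) = Efl n e j := by
  apply le_antisymm
  · rw [Efl, map_span, span_le]
    rintro _ ⟨_, ⟨i, hi, rfl⟩, rfl⟩
    rw [Basis.constr_basis]
    exact hf.mem_Efl hi
  · induction j with
    | zero => simp [Efl_zero]
    | succ j ih =>
      have ih := ih (by omega)
      refine span_le.mpr ?_
      rintro _ ⟨i, hi, rfl⟩
      have hi' : (i : ℕ) < j + 1 := hi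
      have h1 : f i - e i ∈ (Efl n e (j + 1)).map (e.constr ℂ f) :=
        map_mono (Efl_mono (Nat.le_succ j)) (ih (Efl_mono (by omega) (hf i)))
      have h2 : f i ∈ (Efl n e (j + 1)).map (e.constr ℂ f) :=
        ⟨e i, basis_mem_Efl hi', by rw [Basis.constr_basis]⟩
      rw [SetLike.mem_coe, ← sub_sub_cancel (f i) (e i)]
      exact sub_mem h2 h1

lemma IsUnitriangular.exists_linearEquiv {f : Fin (2 * n + 1) → E}
    (hf : IsUnitriangular n e f) :
    ∃ g : E ≃ₗ[ℂ] E, (∀ i, g (e i) = f i) ∧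
      ∀ j ≤ 2 * n + 1, (Efl n e j).map (g : E →ₗ[ℂ] E) = Efl n e j := by
  have : FiniteDimensional ℂ E := e.finiteDimensional_of_finite
  have hsurj : Function.Surjective (e.constr ℂ f) := by
    rw [← LinearMap.range_eq_top, ← Submodule.map_top, ← Efl_eq_top (e := e) le_rfl]
    exact hf.map_constr_Efl le_rfl
  refine ⟨LinearEquiv.ofBijective (e.constr ℂ f)
    ⟨LinearMap.injective_iff_surjective.mpr hsurj, hsurj⟩, fun i => ?_, fun j hj => ?_⟩
  · exact e.constr_basis ℂ f i
  · exact hf.map_constr_Efl hj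

lemma eq_span_image_jumpSet {V : Submodule ℂ E} {f : Fin (2 * n + 1) → E}
    (hf : IsUnitriangular n e f) (hV : ∀ i ∈ jumpSet n e V, f i ∈ V) :
    V = span ℂ (f '' jumpSet n e V) := by
  apply le_antisymm
  · have key : ∀ j ≤ 2 * n + 1, V ⊓ Efl n e j ≤ span ℂ (f '' jumpSet n e V) := by
      intro j hj
      induction j with
      | zero => simp [Efl_zero]
      | succ j ih =>
        have ih := ih (by omega)
        rintro x ⟨hxV, hx⟩
        let i : Fin (2 * n + 1) := ⟨j, by omega⟩
        have hxi : x - e.repr x i • e i ∈ Efl n e i := sub_smul_mem_Efl hx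
        by_cases hc : e.repr x i = 0
        · rw [hc, zero_smul, sub_zero] at hxi
          exact ih ⟨hxV, hxi⟩
        · have hi : i ∈ jumpSet n e V := by
            refine ⟨(e.repr x i)⁻¹ • x, V.smul_mem _ hxV, ?_⟩
            have := (Efl n e i).smul_mem (e.repr x i)⁻¹ hxi
            rwa [smul_sub, smul_smul, inv_mul_cancel₀ hc, one_smul] at this
          have hlow : x - e.repr x i • f i ∈ Efl n e i := by
            have := sub_mem hxi ((Efl n e i).smul_mem (e.repr x i) (hf i))
            convert this using 1
            module
          have hmem := ih ⟨V.sub_mem hxV (V.smul_mem (e.repr x i) (hV i hi)), hlow⟩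
          have := add_mem hmem (smul_mem _ (e.repr x i) (subset_span ⟨i, hi, rfl⟩))
          simpa using this
    simpa [Efl_eq_top (e := e) le_rfl] using key (2 * n + 1) le_rfl
  · rw [span_le]
    rintro _ ⟨i, hi, rfl⟩
    exact hV i hi

lemma mem_jumpSet_iff {V : Submodule ℂ E} {i : Fin (2 * n + 1)} :
    i ∈ jumpSet n e V ↔
      finrank ℂ ↥(V ⊓ Efl n e i) ≠ finrank ℂ ↥(V ⊓ Efl n e (i + 1)) := by
  have : FiniteDimensional ℂ E := e.finiteDimensional_of_finite
  have hle : V ⊓ Efl n e i ≤ V ⊓ Efl n e (i + 1) :=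
    inf_le_inf_left V (Efl_mono (Nat.le_succ _))
  constructor
  · rintro ⟨v, hv, hvi⟩ heq
    have hmem : v ∈ V ⊓ Efl n e (i + 1) := by
      refine ⟨hv, ?_⟩
      simpa using add_mem (Efl_mono (Nat.le_succ _) hvi) (basis_mem_Efl (Nat.lt_succ_self _))
    rw [← eq_of_le_of_finrank_eq hle heq] at hmem
    have hei : e i ∈ Efl n e i := by simpa using sub_mem hmem.2 hvi
    simpa using (mem_Efl_iff.mp hei i le_rfl)
  · intro hne
    have : ¬ V ⊓ Efl n e (i + 1) ≤ V ⊓ Efl n e i := fun h => hne (by rw [le_antisymm hle h])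
    obtain ⟨x, ⟨hxV, hx⟩, hnot⟩ := SetLike.not_le_iff_exists.mp this
    have hxi := sub_smul_mem_Efl hx
    have hc : e.repr x i ≠ 0 := by
      intro hc
      rw [hc, zero_smul, sub_zero] at hxi
      exact hnot ⟨hxV, hxi⟩
    refine ⟨(e.repr x i)⁻¹ • x, V.smul_mem _ hxV, ?_⟩
    have := (Efl n e i).smul_mem (e.repr x i)⁻¹ hxi
    rwa [smul_sub, smul_smul, inv_mul_cancel₀ hc, one_smul] at this

lemma jumpSet_eq_of_finrank_eq {V V' : Submodule ℂ E}
    (h : ∀ j : ℕ, 1 ≤ j → j ≤ 2 * n + 1 →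
      finrank ℂ ↥(V ⊓ Efl n e j) = finrank ℂ ↥(V' ⊓ Efl n e j)) :
    jumpSet n e V = jumpSet n e V' := by
  have h' : ∀ j ≤ 2 * n + 1,
      finrank ℂ ↥(V ⊓ Efl n e j) = finrank ℂ ↥(V' ⊓ Efl n e j) := by
    intro j hj
    rcases Nat.eq_zero_or_pos j with rfl | hpos
    · have hbot : V ⊓ Efl n e 0 = V' ⊓ Efl n e 0 := by simp [Efl_zero]
      rw [hbot]
    · exact h j hpos hj
  ext i
  rw [mem_jumpSet_iff, mem_jumpSet_iff, h' _ (by omega), h' _ (by omega)]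

end Flag

section Symplectic

variable {n : ℕ} {e : Basis (Fin (2 * n + 1)) ℂ E} {ω : LinearMap.BilinForm ℂ E}

lemma form_eq_zero_of_mem_Efl
    (h0 : ∀ i j : Fin (2 * n + 1), (i : ℕ) + j ≠ 2 * n + 1 → ω (e i) (e j) = 0)
    {a b : ℕ} (hab : a + b ≤ 2 * n + 2) {x y : E} (hx : x ∈ Efl n e a) (hy : y ∈ Efl n e b) :
    ω x y = 0 := by
  have h1 : Efl n e a ≤ LinearMap.ker (ω.flip y) := by
    rw [Efl, span_le]
    rintro _ ⟨i, hi, rfl⟩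
    have h2 : Efl n e b ≤ LinearMap.ker (ω (e i)) := by
      rw [Efl, span_le]
      rintro _ ⟨j, hj, rfl⟩
      have hi' : (i : ℕ) < a := hi
      have hj' : (j : ℕ) < b := hj
      exact h0 i j (by omega)
    exact h2 hy
  exact h1 hx

lemma form_eq_of_sub_mem_Efl
    (h0 : ∀ i j : Fin (2 * n + 1), (i : ℕ) + j ≠ 2 * n + 1 → ω (e i) (e j) = 0)
    {i j : Fin (2 * n + 1)} (hij : (i : ℕ) + j ≤ 2 * n + 1) {x y : E}
    (hx : x - e i ∈ Efl n e i) (hy : y - e j ∈ Efl n e j) :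
    ω x y = ω (e i) (e j) := by
  have hy' : y ∈ Efl n e (j + 1) := by
    simpa using add_mem (Efl_mono (Nat.le_succ _) hy) (basis_mem_Efl (Nat.lt_succ_self _))
  have h1 : ω (x - e i) y = 0 := form_eq_zero_of_mem_Efl h0 (by omega) hx hy'
  have h2 : ω (e i) (y - e j) = 0 :=
    form_eq_zero_of_mem_Efl h0 (a := i + 1) (by omega) (basis_mem_Efl (Nat.lt_succ_self _)) hy
  rw [map_sub, LinearMap.sub_apply, sub_eq_zero] at h1
  rw [map_sub, sub_eq_zero] at h2
  rw [h1, h2]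

/-- A functional vanishing on a step of the flag is represented by a vector of the
complementary step. -/
lemma exists_mem_Efl_form_eq
    (h0 : ∀ i j : Fin (2 * n + 1), (i : ℕ) + j ≠ 2 * n + 1 → ω (e i) (e j) = 0)
    (h1 : ∀ i j : Fin (2 * n + 1), (i : ℕ) + j = 2 * n + 1 → ω (e i) (e j) ≠ 0)
    {m : ℕ} (hm : m ≤ 2 * n + 1) (ψ : E →ₗ[ℂ] ℂ)
    (hψ : ∀ j : Fin (2 * n + 1), m + (j : ℕ) ≤ 2 * n + 1 → ψ (e j) = 0) :
    ∃ x ∈ Efl n e m, ω x = ψ := by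
  let d : Fin (2 * n + 1) → Fin (2 * n + 1) := fun i => Fin.ofNat _ (2 * n + 1 - i)
  have hd : ∀ i : Fin (2 * n + 1), 0 < (i : ℕ) → (d i : ℕ) = 2 * n + 1 - i := by
    intro i hi
    exact Nat.mod_eq_of_lt (by omega)
  refine ⟨∑ a : Fin (2 * n + 1) with 0 < a.val ∧ a.val < m, (ψ (e (d a)) / ω (e a) (e (d a))) • e a, ?_, ?_⟩
  · refine sum_mem fun a ha => smul_mem _ _ (basis_mem_Efl ?_)
    exact (Finset.mem_filter.mp ha).2.2
  · refine e.ext fun j => ?_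
    rw [map_sum, LinearMap.sum_apply]
    by_cases hj : m + (j : ℕ) ≤ 2 * n + 1
    · rw [hψ j hj]
      refine Finset.sum_eq_zero fun a ha => ?_
      have := (Finset.mem_filter.mp ha).2
      rw [map_smul, LinearMap.smul_apply, h0 a j (by omega), smul_zero]
    · have hj0 : 0 < (j : ℕ) := by omega
      have hdj := hd j hj0
      have hddj : d (d j) = j := Fin.ext (by rw [hd _ (by omega)]; omega)
      rw [Finset.sum_eq_single (d j)]
      · rw [map_smul, LinearMap.smul_apply, hddj, smul_eq_mul,
          div_mul_cancel₀ _ (h1 (d j) j (by omega))]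
      · intro a _ ha
        have : (a : ℕ) ≠ d j := fun h => ha (Fin.ext h)
        rw [map_smul, LinearMap.smul_apply, h0 a j (by omega), smul_zero]
      · intro hnot
        exact absurd (Finset.mem_filter.mpr ⟨Finset.mem_univ _, by omega, by omega⟩) hnot

lemma IsUnitriangular.exists_form_eq {f : Fin (2 * n + 1) → E} (hf : IsUnitriangular n e f)
    (h0 : ∀ i j : Fin (2 * n + 1), (i : ℕ) + j ≠ 2 * n + 1 → ω (e i) (e j) = 0)
    (h1 : ∀ i j : Fin (2 * n + 1), (i : ℕ) + j = 2 * n + 1 → ω (e i) (e j) ≠ 0)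
    (m : Fin (2 * n + 1)) :
    ∃ y, y - e m ∈ Efl n e m ∧ ∀ j, ω y (f j) = ω (e m) (e j) := by
  obtain ⟨g, hg, hgE⟩ := hf.exists_linearEquiv
  let ψ : E →ₗ[ℂ] ℂ := ω (e m) ∘ₗ (g.symm : E →ₗ[ℂ] E) - ω (e m)
  have hψf : ∀ j, ψ (f j) = ω (e m) (e j) - ω (e m) (f j) := by
    intro j
    simp [ψ, ← hg]
  obtain ⟨x, hx, hxψ⟩ := exists_mem_Efl_form_eq h0 h1 m.is_lt.le ψ (by
    intro j hj
    have hker : Efl n e (j + 1) ≤ LinearMap.ker ψ := by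
      rw [← hgE (j + 1) (by omega), Efl, map_span, span_le]
      rintro _ ⟨_, ⟨i, hi, rfl⟩, rfl⟩
      have hi' : (i : ℕ) < j + 1 := hi
      have hrel : ω (e m) (f i) = ω (e m) (e i) :=
        form_eq_of_sub_mem_Efl h0 (by omega) (by simp) (hf i)
      change ψ (g (e i)) = 0
      rw [hg, hψf, hrel, sub_self]
    exact hker (basis_mem_Efl (Nat.lt_succ_self _)))
  refine ⟨e m + x, by simpa using hx, fun j => ?_⟩
  rw [map_add, LinearMap.add_apply, hxψ, hψf]
  ring

lemma exists_isUnitriangular_form_eq (halt : ω.IsAlt)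
    (h0 : ∀ i j : Fin (2 * n + 1), (i : ℕ) + j ≠ 2 * n + 1 → ω (e i) (e j) = 0)
    (h1 : ∀ i j : Fin (2 * n + 1), (i : ℕ) + j = 2 * n + 1 → ω (e i) (e j) ≠ 0)
    {V : Submodule ℂ E} (hV : IsIsotropic ω V) :
    ∃ f, IsUnitriangular n e f ∧ (∀ i ∈ jumpSet n e V, f i ∈ V) ∧
      ∀ i j, ω (f i) (f j) = ω (e i) (e j) := by
  classical
  have key : ∀ T : Finset (Fin (2 * n + 1)), ∃ f, IsUnitriangular n e f ∧
      (∀ i ∈ jumpSet n e V, f i ∈ V) ∧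
      ∀ i j, (i ∈ jumpSet n e V ∨ i ∈ T) → (j ∈ jumpSet n e V ∨ j ∈ T) →
        ω (f i) (f j) = ω (e i) (e j) := by
    intro T
    induction T using Finset.induction_on with
    | empty =>
      have hex : ∀ i : Fin (2 * n + 1), ∃ x, x - e i ∈ Efl n e i ∧ (i ∈ jumpSet n e V → x ∈ V) := by
        intro i
        by_cases hi : i ∈ jumpSet n e V
        · obtain ⟨v, hv, hvi⟩ := hi
          exact ⟨v, hvi, fun _ => hv⟩
        · exact ⟨e i, by simp, fun h => absurd h hi⟩
      choose f hf hfV using hex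
      refine ⟨f, hf, hfV, fun i j hi hj => ?_⟩
      by_cases hij : (i : ℕ) + j = 2 * n + 1
      · exact form_eq_of_sub_mem_Efl h0 hij.le (hf i) (hf j)
      · rw [h0 i j hij]
        exact hV _ (hfV i (by simpa using hi)) _ (hfV j (by simpa using hj))
    | insert m T _ ih =>
      obtain ⟨f, hf, hfV, hform⟩ := ih
      by_cases hm : m ∈ jumpSet n e V
      · refine ⟨f, hf, hfV, fun i j hi hj => hform i j ?_ ?_⟩
        · rcases hi with hi | hi
          · exact Or.inl hi
          · rcases Finset.mem_insert.mp hi with rfl | hi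
            exacts [Or.inl hm, Or.inr hi]
        · rcases hj with hj | hj
          · exact Or.inl hj
          · rcases Finset.mem_insert.mp hj with rfl | hj
            exacts [Or.inl hm, Or.inr hj]
      · obtain ⟨y, hy, hyf⟩ := hf.exists_form_eq h0 h1 m
        refine ⟨Function.update f m y, fun i => ?_, fun i hi => ?_, fun i j hi hj => ?_⟩
        · rcases eq_or_ne i m with rfl | him
          · simpa using hy
          · simpa [him] using hf i
        · have him : i ≠ m := by
            rintro rfl
            exact hm hi
          simpa [him] using hfV i hi
        · rw [Finset.mem_insert] at hi hj
          rcases eq_or_ne i m with rfl | him <;> rcases eq_or_ne j i with rfl | hji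
          · rw [halt, halt]
          · simpa [hji] using hyf j
          · rw [halt, halt]
          · rcases eq_or_ne j m with rfl | hjm
            · rw [← halt.neg_eq, ← halt.neg_eq (e j)]
              simpa [him] using hyf i
            · simpa [him, hjm] using hform i j (by tauto) (by tauto)
  obtain ⟨f, hf, hfV, hform⟩ := key Finset.univ
  exact ⟨f, hf, hfV, fun i j => hform i j (by simp) (by simp)⟩

/-- An isotropic subspace is the image, under an element of the Borel subgroup, of the coordinate
subspace given by its jump set. -/
lemma exists_sympGroup_map_span_jumpSet (halt : ω.IsAlt)
    (h0 : ∀ i j : Fin (2 * n + 1), (i : ℕ) + j ≠ 2 * n + 1 → ω (e i) (e j) = 0)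
    (h1 : ∀ i j : Fin (2 * n + 1), (i : ℕ) + j = 2 * n + 1 → ω (e i) (e j) ≠ 0)
    {V : Submodule ℂ E} (hV : IsIsotropic ω V) :
    ∃ g ∈ sympGroup ω,
      (∀ j ≤ 2 * n + 1, (Efl n e j).map ((g : E ≃ₗ[ℂ] E) : E →ₗ[ℂ] E) = Efl n e j) ∧
      (span ℂ (e '' jumpSet n e V)).map ((g : E ≃ₗ[ℂ] E) : E →ₗ[ℂ] E) = V := by
  obtain ⟨f, hf, hfV, hform⟩ := exists_isUnitriangular_form_eq halt h0 h1 hV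
  obtain ⟨g, hg, hgE⟩ := hf.exists_linearEquiv
  refine ⟨g, ?_, hgE, ?_⟩
  · have : ω.compl₁₂ (g : E →ₗ[ℂ] E) (g : E →ₗ[ℂ] E) = ω :=
      LinearMap.ext_basis e e fun i j => by simp [hg, hform]
    intro x y
    exact LinearMap.congr_fun₂ this x y
  · conv_rhs => rw [eq_span_image_jumpSet hf hfV]
    rw [map_span, Set.image_image]
    simp [hg]

end Symplectic

/-- Fix `1 ≤ k ≤ n+1` and let `B` be the Borel subgroup of the odd
symplectic group of elements preserving the reference flag `E_•`.  Two `k`-dimensional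
isotropic subspaces `V, V'` of `E` lie in the same `B`-orbit if and only if they have the
same incidence with `E_•`, i.e. `dim(V ∩ E_j) = dim(V' ∩ E_j)` for all `1 ≤ j ≤ 2n+1`. -/
theorem schubert_cells_are_borel_orbits_grassmannian
    (n k : ℕ) (hn : 1 ≤ n) (hk1 : 1 ≤ k) (hkn : k ≤ n + 1)
    [FiniteDimensional ℂ E] (hdim : finrank ℂ E = 2 * n + 1)
    (ω : LinearMap.BilinForm ℂ E) (halt : ω.IsAlt)
    (e : Basis (Fin (2 * n + 1)) ℂ E)
    (he : ∀ i j : Fin (2 * n + 1), (i : ℕ) < (j : ℕ) →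
      ω (e i) (e j) = if (i : ℕ) + (j : ℕ) = 2 * n + 1 then 1 else 0) :
    ∀ V V' : Submodule ℂ E,
      finrank ℂ V = k → IsIsotropic ω V →
      finrank ℂ V' = k → IsIsotropic ω V' →
      ((∃ g ∈ sympGroup ω,
          (∀ j : ℕ, j ≤ 2 * n + 1 →
            Submodule.map ((g : E ≃ₗ[ℂ] E) : E →ₗ[ℂ] E) (Efl n e j) = Efl n e j) ∧
          Submodule.map ((g : E ≃ₗ[ℂ] E) : E →ₗ[ℂ] E) V = V') ↔
        (∀ j : ℕ, 1 ≤ j → j ≤ 2 * n + 1 →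
          finrank ℂ ↥(V ⊓ Efl n e j) = finrank ℂ ↥(V' ⊓ Efl n e j))) := by
  have h0 : ∀ i j : Fin (2 * n + 1), (i : ℕ) + j ≠ 2 * n + 1 → ω (e i) (e j) = 0 := by
    intro i j hij
    rcases lt_trichotomy (i : ℕ) j with h | h | h
    · rw [he i j h, if_neg hij]
    · rw [Fin.ext h, halt]
    · rw [← halt.neg_eq, he j i h, if_neg (by omega), neg_zero]
  have h1 : ∀ i j : Fin (2 * n + 1), (i : ℕ) + j = 2 * n + 1 → ω (e i) (e j) ≠ 0 := by
    intro i j hij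
    rcases lt_trichotomy (i : ℕ) j with h | h | h
    · rw [he i j h, if_pos hij]
      exact one_ne_zero
    · omega
    · rw [← halt.neg_eq, he j i h, if_pos (by omega)]
      exact neg_ne_zero.mpr one_ne_zero
  intro V V' _ hV _ hV'
  constructor
  · rintro ⟨g, -, hgE, hgV⟩ j - hj
    rw [← hgV]
    conv_rhs => rw [← hgE j hj]
    rw [← Submodule.map_inf _ g.injective]
    exact (LinearEquiv.finrank_map_eq g _).symm
  · intro h
    obtain ⟨g, hg, hgE, hgV⟩ := exists_sympGroup_map_span_jumpSet halt h0 h1 hV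
    obtain ⟨g', hg', hgE', hgV'⟩ := exists_sympGroup_map_span_jumpSet halt h0 h1 hV'
    have hinv : ∀ W U : Submodule ℂ E, W.map (g : E →ₗ[ℂ] E) = U →
        U.map ((g' * g⁻¹ : E ≃ₗ[ℂ] E) : E →ₗ[ℂ] E) = W.map (g' : E →ₗ[ℂ] E) := by
      rintro W _ rfl
      rw [← Submodule.map_comp]
      congr 1
      ext x
      exact congrArg g' (g.symm_apply_apply x)
    refine ⟨g' * g⁻¹, mul_mem hg' (inv_mem hg), fun j hj => ?_, ?_⟩
    · rw [hinv _ _ (hgE j hj), hgE' j hj]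
    · rw [hinv _ _ hgV, jumpSet_eq_of_finrank_eq h, hgV']

end
end
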